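/- Let s ≥ 1 and ψ ∈ H^s(Ω). Define r₂ = ∫₀^τ ∫₀^θ F'_θ(ψ) F_{θ₁}(ψ) dθ₁ dθ for τ > 0, where F'_θ(ψ)(·) is the derivative of F_θ at ψ. Then, using the cancellation F'_{τ/2}(ψ)(F_{τ/2}(ψ)) = 0, one has the bound ‖r₂‖_s ≤ C (τ³ + τ⁴) ‖ψ‖_s^{2p+1} for a constant C > 0 depending only on s, p and Ω. -/

import Mathlib

/- Periodic functions on Ω = (a,b) are represented by their Fourier coefficient
sequences `c : ℤ → ℂ`, i.e. `z(x) = ∑_{l∈ℤ} c l * exp(i μ_l (x−a))` with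
`μ_l = 2πl/(b−a)`.  All operators are expressed on the Fourier side:
`⟨∇⟩`, `⟨∇⟩⁻¹`, `e^{it⟨∇⟩}` act diagonally, complex conjugation of the function
corresponds to `l ↦ conj (c (−l))`, and the pointwise product of two functions
corresponds to the convolution of their coefficient sequences. -/

noncomputable section

namespace NKGE

/-- Fourier frequency `μ_l = 2πl/(b−a)`. -/
def mu (a b : ℝ) (l : ℤ) : ℝ := 2 * Real.pi * l / (b - a)

/-- `ζ_l = √(1+μ_l²)`, the Fourier symbol of `⟨∇⟩ = √(1−∂_xx)`. -/
def zeta (a b : ℝ) (l : ℤ) : ℝ := Real.sqrt (1 + mu a b l ^ 2)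

/-- Squared `H^s`-norm: `‖z‖_s² = ∑_l (1+μ_l²)^s |ẑ_l|²`. -/
def sobNormSq (a b s : ℝ) (c : ℤ → ℂ) : ℝ := ∑' l : ℤ, (1 + mu a b l ^ 2) ^ s * ‖c l‖ ^ 2

/-- The `H^s`-norm `‖z‖_s`. -/
def sobNorm (a b s : ℝ) (c : ℤ → ℂ) : ℝ := Real.sqrt (sobNormSq a b s c)

/-- Membership in `H^s(Ω)`. -/
def MemHs (a b s : ℝ) (c : ℤ → ℂ) : Prop :=
  Summable fun l : ℤ => (1 + mu a b l ^ 2) ^ s * ‖c l‖ ^ 2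

/-- The operator `⟨∇⟩` acting in Fourier space. -/
def opJ (a b : ℝ) (c : ℤ → ℂ) : ℤ → ℂ := fun l => (zeta a b l : ℂ) * c l

/-- The operator `⟨∇⟩⁻¹` acting in Fourier space. -/
def opJinv (a b : ℝ) (c : ℤ → ℂ) : ℤ → ℂ := fun l => c l / (zeta a b l : ℂ)

/-- The operator `e^{it⟨∇⟩}` acting in Fourier space. -/
def expJ (a b t : ℝ) (c : ℤ → ℂ) : ℤ → ℂ :=
  fun l => Complex.exp (Complex.I * (t : ℂ) * (zeta a b l : ℂ)) * c l

/-- Fourier coefficients of the complex conjugate function `z̄`. -/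
def conjC (c : ℤ → ℂ) : ℤ → ℂ := fun l => (starRingEnd ℂ) (c (-l))

/-- Convolution of coefficient sequences = coefficients of the pointwise product. -/
def convC (c d : ℤ → ℂ) : ℤ → ℂ := fun l => ∑' m : ℤ, c m * d (l - m)

/-- Coefficients of the constant function `1`. -/
def oneC : ℤ → ℂ := fun l => if l = 0 then 1 else 0

/-- Coefficients of the `n`-th pointwise power `z^n`. -/
def powC (c : ℤ → ℂ) : ℕ → ℤ → ℂ
  | 0 => oneC
  | n + 1 => convC c (powC c n)

/-- Coefficients of `(ψ + ψ̄)/2`. -/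
def reC (c : ℤ → ℂ) : ℤ → ℂ := fun l => (c l + conjC c l) / 2

/-- Coefficients of `φ + φ̄`. -/
def addConj (c : ℤ → ℂ) : ℤ → ℂ := fun l => c l + conjC c l

/-- `G(φ) = f((φ+φ̄)/2)` with `f(v) = v^{p+1}`. -/
def Gop (p : ℕ) (c : ℤ → ℂ) : ℤ → ℂ := powC (reC c) (p + 1)

/-- `F(φ) = i ⟨∇⟩⁻¹ G(φ)`. -/
def Fop (a b : ℝ) (p : ℕ) (c : ℤ → ℂ) : ℤ → ℂ := fun l => Complex.I * opJinv a b (Gop p c) l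

/-- `F_t(φ) = e^{−it⟨∇⟩} F(e^{it⟨∇⟩} φ)`. -/
def Ft (a b : ℝ) (p : ℕ) (t : ℝ) (c : ℤ → ℂ) : ℤ → ℂ :=
  expJ a b (-t) (Fop a b p (expJ a b t c))

/-- `F'(φ)(η) = ((p+1)i/2^{p+1}) ⟨∇⟩⁻¹((φ+φ̄)^p (η+η̄))`. -/
def Fd (a b : ℝ) (p : ℕ) (φ η : ℤ → ℂ) : ℤ → ℂ :=
  fun l => ((p : ℂ) + 1) * Complex.I / 2 ^ (p + 1) *
    opJinv a b (convC (powC (addConj φ) p) (addConj η)) l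

/-- `F_t'(φ)(η) = e^{−it⟨∇⟩} F'(e^{it⟨∇⟩}φ)(e^{it⟨∇⟩}η)`. -/
def Ftd (a b : ℝ) (p : ℕ) (t : ℝ) (φ η : ℤ → ℂ) : ℤ → ℂ :=
  expJ a b (-t) (Fd a b p (expJ a b t φ) (expJ a b t η))

/-- `F''(φ)(η,ζ) = (p(p+1)i/2^{p+1}) ⟨∇⟩⁻¹((φ+φ̄)^{p−1}(η+η̄)(ζ+ζ̄))`. -/
def Fdd (a b : ℝ) (p : ℕ) (φ η ζ : ℤ → ℂ) : ℤ → ℂ :=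
  fun l => (p : ℂ) * ((p : ℂ) + 1) * Complex.I / 2 ^ (p + 1) *
    opJinv a b (convC (convC (powC (addConj φ) (p - 1)) (addConj η)) (addConj ζ)) l

/-- `F_t''(φ)(η,ζ) = e^{−it⟨∇⟩} F''(e^{it⟨∇⟩}φ)(e^{it⟨∇⟩}η, e^{it⟨∇⟩}ζ)`. -/
def Ftdd (a b : ℝ) (p : ℕ) (t : ℝ) (φ η ζ : ℤ → ℂ) : ℤ → ℂ :=
  expJ a b (-t) (Fdd a b p (expJ a b t φ) (expJ a b t η) (expJ a b t ζ))

/-- The flow `φ_V^t(ψ₀) = ψ₀ + ε^p t F(ψ₀)` of the nonlinear subproblem. -/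
def flowV (a b : ℝ) (p : ℕ) (ε t : ℝ) (c : ℤ → ℂ) : ℤ → ℂ :=
  fun l => c l + (ε ^ p * t) • Fop a b p c l

/-- The Strang splitting operator `S_τ = φ_T^{τ/2} ∘ φ_V^{τ} ∘ φ_T^{τ/2}`. -/
def strang (a b : ℝ) (p : ℕ) (ε τ : ℝ) (c : ℤ → ℂ) : ℤ → ℂ :=
  expJ a b (τ / 2) (flowV a b p ε τ (expJ a b (τ / 2) c))

/-- The alternative Strang splitting `S̃_τ = φ_V^{τ/2} ∘ φ_T^{τ} ∘ φ_V^{τ/2}`. -/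
def strang2 (a b : ℝ) (p : ℕ) (ε τ : ℝ) (c : ℤ → ℂ) : ℤ → ℂ :=
  flowV a b p ε (τ / 2) (expJ a b τ (flowV a b p ε (τ / 2) c))

/-- `Ψ` is an exact solution of the relativistic NLSE
`i∂_tψ + ⟨∇⟩ψ + ε^p ⟨∇⟩⁻¹ G(ψ) = 0`, written on the Fourier side, i.e.
`ψ' = i(ζ_l ψ_l + ε^p ζ_l⁻¹ (G(ψ))_l)`. -/
def IsExactSol (a b : ℝ) (p : ℕ) (ε : ℝ) (Ψ : ℝ → ℤ → ℂ) : Prop :=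
  ∀ (t : ℝ) (l : ℤ), HasDerivAt (fun s => Ψ s l)
    (Complex.I * ((zeta a b l : ℂ) * Ψ t l + (ε ^ p : ℂ) * Gop p (Ψ t) l / (zeta a b l : ℂ))) t

/-- Pointwise-in-`t` derivative `∂_t F_t(φ)`. -/
def dFt (a b : ℝ) (p : ℕ) (t : ℝ) (c : ℤ → ℂ) : ℤ → ℂ :=
  fun l => deriv (fun τ => Ft a b p τ c l) t

/-- Second derivative `∂_t² F_t(φ)`. -/
def d2Ft (a b : ℝ) (p : ℕ) (t : ℝ) (c : ℤ → ℂ) : ℤ → ℂ :=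
  fun l => deriv (fun τ => dFt a b p τ c l) t

/-- Derivative `∂_t F_t'(φ)(η)`. -/
def dFtd (a b : ℝ) (p : ℕ) (t : ℝ) (φ η : ℤ → ℂ) : ℤ → ℂ :=
  fun l => deriv (fun τ => Ftd a b p τ φ η l) t


open scoped ENNReal

def convE (f g : ℤ → ℝ≥0∞) : ℤ → ℝ≥0∞ := fun l => ∑' m : ℤ, f m * g (l - m)

def powE (c : ℤ → ℝ≥0∞) : ℕ → ℤ → ℝ≥0∞
  | 0 => fun l => if l = 0 then 1 else 0
  | n + 1 => convE c (powE c n)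

def NE (W f : ℤ → ℝ≥0∞) : ℝ≥0∞ := ∑' l, W l * f l ^ 2

lemma convE_mono {f f' g g' : ℤ → ℝ≥0∞} (hf : ∀ l, f l ≤ f' l) (hg : ∀ l, g l ≤ g' l) (l : ℤ) :
    convE f g l ≤ convE f' g' l :=
  ENNReal.tsum_le_tsum fun m => mul_le_mul' (hf m) (hg _)

lemma enorm_convC_le {c d : ℤ → ℂ} {f g : ℤ → ℝ≥0∞} (hf : ∀ l, ‖c l‖ₑ ≤ f l)
    (hg : ∀ l, ‖d l‖ₑ ≤ g l) (l : ℤ) : ‖convC c d l‖ₑ ≤ convE f g l := by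
  refine (enorm_tsum_le_tsum_enorm).trans ?_
  refine ENNReal.tsum_le_tsum fun m => ?_
  rw [enorm_mul]
  exact mul_le_mul' (hf m) (hg _)

lemma enorm_powC_le {c : ℤ → ℂ} {f : ℤ → ℝ≥0∞} (hf : ∀ l, ‖c l‖ₑ ≤ f l) (n : ℕ) :
    ∀ l : ℤ, ‖powC c n l‖ₑ ≤ powE f n l := by
  induction n with
  | zero => intro l; simp only [powC, powE, oneC]; split_ifs <;> simp
  | succ n ih => intro l; exact enorm_convC_le hf ih l

lemma cs_tsum (u v : ℤ → ℝ≥0∞) : (∑' m, u m * v m) ^ 2 ≤ (∑' m, u m ^ 2) * ∑' m, v m ^ 2 := by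
  have h := ENNReal.lintegral_mul_le_Lp_mul_Lq (MeasureTheory.Measure.count : MeasureTheory.Measure ℤ)
    (p := 2) (q := 2) (Real.holderConjugate_iff.mpr ⟨by norm_num, by norm_num⟩)
    (f := u) (g := v) (measurable_of_countable _).aemeasurable (measurable_of_countable _).aemeasurable
  simp only [MeasureTheory.lintegral_count, Pi.mul_apply, ENNReal.rpow_ofNat] at h
  calc _ ≤ ((∑' m, u m ^ 2) ^ (1 / 2 : ℝ) * (∑' m, v m ^ 2) ^ (1 / 2 : ℝ)) ^ 2 := by gcongr
    _ = _ := by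
      rw [mul_pow, ← ENNReal.rpow_natCast, ← ENNReal.rpow_natCast, ← ENNReal.rpow_mul,
        ← ENNReal.rpow_mul]
      norm_num

lemma cs_weight (w h : ℤ → ℝ≥0∞) (h0 : ∀ m, w m ≠ 0) (ht : ∀ m, w m ≠ ∞) :
    (∑' m, h m) ^ 2 ≤ (∑' m, (w m)⁻¹) * ∑' m, w m * h m ^ 2 := by
  have := cs_tsum (fun m => (w m)⁻¹ ^ (1 / 2 : ℝ)) (fun m => w m ^ (1 / 2 : ℝ) * h m)
  have e1 : ∀ m, (w m)⁻¹ ^ (1 / 2 : ℝ) * (w m ^ (1 / 2 : ℝ) * h m) = h m := by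
    intro m
    rw [← mul_assoc, ← ENNReal.mul_rpow_of_nonneg _ _ (by norm_num),
      ENNReal.inv_mul_cancel (h0 m) (ht m)]
    simp
  have e2 : ∀ x : ℝ≥0∞, (x ^ (1 / 2 : ℝ)) ^ 2 = x := by
    intro x
    rw [← ENNReal.rpow_natCast, ← ENNReal.rpow_mul]; norm_num
  simpa only [e1, e2, mul_pow] using this

lemma NE_conv (W : ℤ → ℝ≥0∞) (C : ℝ≥0∞) (h0 : ∀ m, W m ≠ 0) (ht : ∀ m, W m ≠ ∞)
    (hW : ∀ l m, W l ≤ C * (W m + W (l - m))) (f g : ℤ → ℝ≥0∞) :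
    NE W (convE f g) ≤ (2 * C * ∑' m, (W m)⁻¹) * (NE W f * NE W g) := by
  have shift : ∀ (k : ℤ → ℝ≥0∞) (l : ℤ), ∑' m, k (l - m) = ∑' m, k m := fun k l =>
    (Equiv.subLeft l).tsum_eq k
  have shift2 : ∀ (k : ℤ → ℝ≥0∞) (m : ℤ), ∑' l, k (l - m) = ∑' m, k m := fun k l =>
    (Equiv.subRight l).tsum_eq k
  have key : ∀ l, W l * convE f g l ^ 2 ≤ (2 * C * ∑' m, (W m)⁻¹) *
      ∑' m, (W m * f m ^ 2) * (W (l - m) * g (l - m) ^ 2) := by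
    intro l
    have h1 := cs_weight (fun m => W m * W (l - m)) (fun m => f m * g (l - m))
      (fun m => mul_ne_zero (h0 _) (h0 _)) (fun m => ENNReal.mul_ne_top (ht _) (ht _))
    have h2 : W l * ∑' m, (W m * W (l - m))⁻¹ ≤ 2 * C * ∑' m, (W m)⁻¹ := by
      rw [← ENNReal.tsum_mul_left]
      calc _ ≤ ∑' m, C * ((W (l - m))⁻¹ + (W m)⁻¹) := by
            refine ENNReal.tsum_le_tsum fun m => ?_
            rw [ENNReal.mul_inv (Or.inl (h0 _)) (Or.inl (ht _))]
            calc _ ≤ C * (W m + W (l - m)) * ((W m)⁻¹ * (W (l - m))⁻¹) := by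
                  gcongr; exact hW l m
              _ = C * ((W m * (W m)⁻¹) * (W (l - m))⁻¹ + (W (l - m) * (W (l - m))⁻¹) * (W m)⁻¹) := by ring
              _ = _ := by
                rw [ENNReal.mul_inv_cancel (h0 _) (ht _), ENNReal.mul_inv_cancel (h0 _) (ht _)]
                simp
        _ = _ := by
          rw [ENNReal.tsum_mul_left, ENNReal.tsum_add, shift (fun m => (W m)⁻¹) l]; ring
    calc _ ≤ W l * ((∑' m, (W m * W (l - m))⁻¹) * ∑' m, W m * W (l - m) * (f m * g (l - m)) ^ 2) := by
          gcongr; exact h1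
      _ = (W l * (∑' m, (W m * W (l - m))⁻¹)) * ∑' m, (W m * f m ^ 2) * (W (l - m) * g (l - m) ^ 2) := by
          rw [mul_assoc]; congr 2; refine tsum_congr fun m => ?_; ring
      _ ≤ _ := by gcongr
  calc _ ≤ ∑' l, (2 * C * ∑' m, (W m)⁻¹) *
      ∑' m, (W m * f m ^ 2) * (W (l - m) * g (l - m) ^ 2) := ENNReal.tsum_le_tsum key
    _ = _ := by
      rw [ENNReal.tsum_mul_left, ENNReal.tsum_comm]
      congr 1
      simp_rw [ENNReal.tsum_mul_left]
      simp_rw [shift2 (fun k => W k * g k ^ 2)]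
      rw [ENNReal.tsum_mul_right]; rfl

lemma NE_pow (W : ℤ → ℝ≥0∞) (K : ℝ≥0∞) (hW0 : W 0 = 1)
    (hK : ∀ f g, NE W (convE f g) ≤ K * (NE W f * NE W g)) (f : ℤ → ℝ≥0∞) (n : ℕ) :
    NE W (powE f n) ≤ K ^ n * NE W f ^ n := by
  induction n with
  | zero =>
    simp only [NE, powE]
    rw [tsum_eq_single 0]
    · simp [hW0]
    · intro b hb; simp [hb]
  | succ n ih =>
    calc _ ≤ K * (NE W f * NE W (powE f n)) := hK _ _
      _ ≤ K * (NE W f * (K ^ n * NE W f ^ n)) := by gcongr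
      _ = _ := by ring

/-! weights -/

def WE (a b s : ℝ) (l : ℤ) : ℝ≥0∞ := ENNReal.ofReal ((1 + mu a b l ^ 2) ^ s)

lemma W_pos (a b s : ℝ) (l : ℤ) : 0 < (1 + mu a b l ^ 2) ^ s := by positivity

lemma WE_zero (a b s : ℝ) : WE a b s 0 = 1 := by simp [WE, mu]

lemma one_le_W (a b s : ℝ) (hs : 1 ≤ s) (l : ℤ) : 1 + mu a b l ^ 2 ≤ (1 + mu a b l ^ 2) ^ s := by
  conv_lhs => rw [← Real.rpow_one (1 + mu a b l ^ 2)]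
  exact Real.rpow_le_rpow_of_exponent_le (by nlinarith [sq_nonneg (mu a b l)]) hs

lemma WE_sub (a b s : ℝ) (hs : 1 ≤ s) (l m : ℤ) :
    WE a b s l ≤ ENNReal.ofReal (4 ^ s) * (WE a b s m + WE a b s (l - m)) := by
  unfold WE
  rw [← ENNReal.ofReal_add (W_pos ..).le (W_pos ..).le, ← ENNReal.ofReal_mul (by positivity)]
  apply ENNReal.ofReal_le_ofReal
  have e : mu a b l = mu a b m + mu a b (l - m) := by simp only [mu]; push_cast; ring
  rw [e]
  generalize mu a b m = x
  generalize mu a b (l - m) = y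
  have hx : 0 < (1 + x ^ 2) ^ s := by positivity
  have hy : 0 < (1 + y ^ 2) ^ s := by positivity
  rcases le_total (x ^ 2) (y ^ 2) with h | h
  · calc (1 + (x + y) ^ 2) ^ s ≤ (4 * (1 + y ^ 2)) ^ s :=
          Real.rpow_le_rpow (by positivity) (by nlinarith [sq_nonneg (x - y)]) (by linarith)
      _ = 4 ^ s * (1 + y ^ 2) ^ s := Real.mul_rpow (by norm_num) (by positivity)
      _ ≤ _ := by gcongr; linarith
  · calc (1 + (x + y) ^ 2) ^ s ≤ (4 * (1 + x ^ 2)) ^ s :=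
          Real.rpow_le_rpow (by positivity) (by nlinarith [sq_nonneg (x - y)]) (by linarith)
      _ = 4 ^ s * (1 + x ^ 2) ^ s := Real.mul_rpow (by norm_num) (by positivity)
      _ ≤ _ := by gcongr; linarith

lemma WE_inv_sum (a b s : ℝ) (hab : a < b) (hs : 1 ≤ s) : ∑' m, (WE a b s m)⁻¹ ≠ ∞ := by
  have hsum : Summable fun m : ℤ => ((1 + mu a b m ^ 2) ^ s)⁻¹ := by
    have h1 : Summable fun m : ℤ => ((b - a) / (2 * Real.pi)) ^ 2 * (1 / (m : ℝ) ^ 2) :=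
      (Real.summable_one_div_int_pow.mpr (by norm_num)).mul_left _
    refine Summable.of_norm_bounded_eventually h1 ?_
    refine (Set.finite_singleton (0 : ℤ)).subset ?_
    intro m hm
    by_contra h0
    apply hm
    have hm0 : (m : ℝ) ≠ 0 := by exact_mod_cast h0
    have hba : b - a ≠ 0 := by linarith
    rw [Set.mem_setOf_eq, Real.norm_of_nonneg (inv_nonneg.mpr (W_pos ..).le)]
    have hmu : mu a b m ≠ 0 := by
      unfold mu; have := Real.pi_ne_zero; positivity
    calc ((1 + mu a b m ^ 2) ^ s)⁻¹ ≤ (mu a b m ^ 2)⁻¹ := by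
          apply inv_anti₀ (by positivity)
          linarith [one_le_W a b s hs m]
      _ = _ := by unfold mu; have := Real.pi_ne_zero; field_simp
  have : ∀ m, (WE a b s m)⁻¹ = ENNReal.ofReal (((1 + mu a b m ^ 2) ^ s)⁻¹) := fun m =>
    (ENNReal.ofReal_inv_of_pos (W_pos ..)).symm
  simp_rw [this]
  rw [← ENNReal.ofReal_tsum_of_nonneg (fun m => inv_nonneg.mpr (W_pos ..).le) hsum]
  exact ENNReal.ofReal_ne_top

lemma term_eq (a b s : ℝ) (c : ℤ → ℂ) (l : ℤ) :
    ENNReal.ofReal ((1 + mu a b l ^ 2) ^ s * ‖c l‖ ^ 2) = WE a b s l * ‖c l‖ₑ ^ 2 := by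
  rw [ENNReal.ofReal_mul (W_pos ..).le, ENNReal.ofReal_pow (norm_nonneg _), ofReal_norm]; rfl

lemma NE_eq (a b s : ℝ) (c : ℤ → ℂ) (h : MemHs a b s c) :
    NE (WE a b s) (fun l => ‖c l‖ₑ) = ENNReal.ofReal (sobNormSq a b s c) := by
  unfold sobNormSq NE
  rw [ENNReal.ofReal_tsum_of_nonneg (fun m => mul_nonneg (W_pos ..).le (by positivity)) h]
  simp_rw [term_eq]

lemma sobNormSq_eq (a b s : ℝ) (c : ℤ → ℂ) :
    sobNormSq a b s c = (NE (WE a b s) (fun l => ‖c l‖ₑ)).toReal := by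
  unfold sobNormSq NE
  simp_rw [← term_eq]
  rw [ENNReal.tsum_toReal_eq (fun _ => ENNReal.ofReal_ne_top)]
  refine tsum_congr fun l => ?_
  rw [ENNReal.toReal_ofReal (mul_nonneg (W_pos ..).le (by positivity))]

/-! structure -/

def cE (ψ : ℤ → ℂ) : ℤ → ℝ≥0∞ := fun l => ‖ψ l‖ₑ + ‖ψ (-l)‖ₑ

lemma NE_cE (a b s : ℝ) (ψ : ℤ → ℂ) :
    NE (WE a b s) (cE ψ) ≤ 4 * NE (WE a b s) (fun l => ‖ψ l‖ₑ) := by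
  have hsym : ∀ l, WE a b s (-l) = WE a b s l := fun l => by
    unfold WE mu; congr 3; push_cast; ring
  calc _ ≤ ∑' l, (2 * (WE a b s l * ‖ψ l‖ₑ ^ 2) + 2 * (WE a b s (-l) * ‖ψ (-l)‖ₑ ^ 2)) := by
        refine ENNReal.tsum_le_tsum fun l => ?_
        rw [hsym, cE]
        have : (‖ψ l‖ₑ + ‖ψ (-l)‖ₑ) ^ 2 ≤ 2 * ‖ψ l‖ₑ ^ 2 + 2 * ‖ψ (-l)‖ₑ ^ 2 := by
          have := ENNReal.rpow_add_le_mul_rpow_add_rpow (‖ψ l‖ₑ) (‖ψ (-l)‖ₑ) (p := 2) (by norm_num)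
          simp only [ENNReal.rpow_ofNat] at this
          norm_num at this
          rwa [mul_add] at this
        calc _ ≤ WE a b s l * (2 * ‖ψ l‖ₑ ^ 2 + 2 * ‖ψ (-l)‖ₑ ^ 2) := by gcongr
          _ = _ := by ring
    _ = _ := by
      rw [ENNReal.tsum_add, ENNReal.tsum_mul_left, ENNReal.tsum_mul_left,
        show ∑' l, WE a b s (-l) * ‖ψ (-l)‖ₑ ^ 2 = ∑' l, WE a b s l * ‖ψ l‖ₑ ^ 2 from
          (Equiv.neg ℤ).tsum_eq (fun l => WE a b s l * ‖ψ l‖ₑ ^ 2)]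
      unfold NE
      ring

lemma zeta_pos (a b : ℝ) (l : ℤ) : 0 < zeta a b l := by unfold zeta; positivity

lemma one_le_zeta (a b : ℝ) (l : ℤ) : 1 ≤ zeta a b l := by
  unfold zeta; rw [Real.one_le_sqrt]; nlinarith [sq_nonneg (mu a b l)]

lemma zeta_neg (a b : ℝ) (l : ℤ) : zeta a b (-l) = zeta a b l := by
  unfold zeta mu; congr 2; push_cast; ring

lemma enorm_exp_aux (t z : ℝ) : ‖Complex.exp (Complex.I * (t : ℂ) * (z : ℂ))‖ₑ = 1 := by
  rw [← ofReal_norm, show Complex.I * (t : ℂ) * (z : ℂ) = ((t * z : ℝ) : ℂ) * Complex.I by push_cast; ring,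
    Complex.norm_exp_ofReal_mul_I]; simp

lemma enorm_addConj_le (a b t : ℝ) (ψ : ℤ → ℂ) (l : ℤ) :
    ‖addConj (expJ a b t ψ) l‖ₑ ≤ cE ψ l := by
  unfold addConj conjC expJ cE
  refine (enorm_add_le _ _).trans ?_
  rw [RCLike.enorm_conj, enorm_mul, enorm_mul, enorm_exp_aux, enorm_exp_aux]
  simp

lemma enorm_reC_le (a b t : ℝ) (ψ : ℤ → ℂ) (l : ℤ) :
    ‖reC (expJ a b t ψ) l‖ₑ ≤ cE ψ l := by
  refine le_trans ?_ (enorm_addConj_le a b t ψ l)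
  change ‖addConj (expJ a b t ψ) l / 2‖ₑ ≤ _
  rw [enorm_le_iff_norm_le, norm_div]
  have := norm_nonneg (addConj (expJ a b t ψ) l)
  simp only [Complex.norm_ofNat]
  linarith

lemma conj_conv (c d : ℤ → ℂ) (hc : conjC c = c) (hd : conjC d = d) :
    conjC (convC c d) = convC c d := by
  funext l
  conv_rhs => rw [← hc, ← hd]
  unfold conjC convC
  rw [Complex.conj_tsum, ← (Equiv.neg ℤ).tsum_eq]
  refine tsum_congr fun m => ?_
  simp only [Equiv.neg_apply, map_mul]
  congr 3
  ring

lemma conj_pow (c : ℤ → ℂ) (hc : conjC c = c) (n : ℕ) : conjC (powC c n) = powC c n := by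
  induction n with
  | zero => funext l; simp only [conjC, powC, oneC, neg_eq_zero]; split_ifs <;> simp
  | succ n ih => exact conj_conv _ _ hc ih

lemma conj_reC (c : ℤ → ℂ) : conjC (reC c) = reC c := by
  funext l
  simp [conjC, reC, add_comm, Complex.conj_ofNat]

lemma addConj_F (a b : ℝ) (p : ℕ) (θ θ₁ : ℝ) (ψ : ℤ → ℂ) (l : ℤ) :
    addConj (expJ a b θ (Ft a b p θ₁ ψ)) l =
      ((-2 * Real.sin ((θ - θ₁) * zeta a b l) / zeta a b l : ℝ) : ℂ) * Gop p (expJ a b θ₁ ψ) l := by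
  have hG : (starRingEnd ℂ) (Gop p (expJ a b θ₁ ψ) (-l)) = Gop p (expJ a b θ₁ ψ) l :=
    congrFun (conj_pow _ (conj_reC (expJ a b θ₁ ψ)) (p + 1)) l
  have hz : (zeta a b l : ℂ) ≠ 0 := by exact_mod_cast (zeta_pos a b l).ne'
  simp only [addConj, conjC, expJ, Ft, Fop, opJinv, map_mul, map_div₀, hG, zeta_neg, ← Complex.exp_conj,
    Complex.conj_I, Complex.conj_ofReal]
  rw [← mul_assoc, ← mul_assoc (Complex.exp _), ← Complex.exp_add, ← Complex.exp_add]
  have e1 : Complex.I * (θ : ℂ) * (zeta a b l : ℂ) + Complex.I * ((-θ₁ : ℝ) : ℂ) * (zeta a b l : ℂ)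
      = ((θ - θ₁) * zeta a b l) * Complex.I := by push_cast; ring
  have e2 : -Complex.I * (θ : ℂ) * (zeta a b l : ℂ) + -Complex.I * ((-θ₁ : ℝ) : ℂ) * (zeta a b l : ℂ)
      = (-((θ - θ₁) * zeta a b l)) * Complex.I := by push_cast; ring
  rw [e1, e2]
  push_cast
  rw [Complex.sin]
  field_simp
  ring

lemma Ftd_zero (a b : ℝ) (p : ℕ) (t : ℝ) (ψ : ℤ → ℂ) (l : ℤ) :
    Ftd a b p t ψ (Ft a b p t ψ) l = 0 := by
  have : addConj (expJ a b t (Ft a b p t ψ)) = fun _ => 0 := by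
    funext k; rw [addConj_F]; simp
  have h2 : convC (powC (addConj (expJ a b t ψ)) p) (addConj (expJ a b t (Ft a b p t ψ))) l = 0 := by
    rw [this]; simp [convC]
  unfold Ftd
  rw [expJ, Fd, opJinv, h2]
  simp

def ME (p : ℕ) (ψ : ℤ → ℂ) : ℤ → ℝ≥0∞ := convE (powE (cE ψ) p) (powE (cE ψ) (p + 1))

lemma convE_const (f g : ℤ → ℝ≥0∞) (k : ℝ≥0∞) (l : ℤ) :
    convE f (fun l => k * g l) l = k * convE f g l := by
  unfold convE
  rw [← ENNReal.tsum_mul_left]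
  refine tsum_congr fun m => ?_
  ring

lemma Ftd_bound (a b : ℝ) (p : ℕ) (θ θ₁ : ℝ) (ψ : ℤ → ℂ) (l : ℤ) :
    ‖Ftd a b p θ ψ (Ft a b p θ₁ ψ) l‖ₑ ≤ ENNReal.ofReal ((p + 1) * (2 * |θ - θ₁|)) * ME p ψ l := by
  have h1 : ∀ l, ‖addConj (expJ a b θ (Ft a b p θ₁ ψ)) l‖ₑ ≤
      ENNReal.ofReal (2 * |θ - θ₁|) * powE (cE ψ) (p + 1) l := by
    intro l
    rw [addConj_F, enorm_mul]
    refine mul_le_mul' ?_ (enorm_powC_le (enorm_reC_le a b θ₁ ψ) (p + 1) l)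
    rw [← ofReal_norm]
    apply ENNReal.ofReal_le_ofReal
    rw [Complex.norm_real, Real.norm_eq_abs, abs_div, abs_of_pos (zeta_pos a b l), abs_mul,
      div_le_iff₀ (zeta_pos a b l)]
    have := Real.abs_sin_le_abs (x := (θ - θ₁) * zeta a b l)
    rw [abs_mul (θ - θ₁), abs_of_pos (zeta_pos a b l)] at this
    norm_num
    linarith
  have h2 := enorm_convC_le (enorm_powC_le (enorm_addConj_le a b θ ψ) p) h1 l
  rw [convE_const] at h2
  unfold Ftd
  rw [expJ, enorm_mul, enorm_exp_aux, one_mul, Fd, opJinv, enorm_mul]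
  rw [ENNReal.ofReal_mul (by positivity), mul_assoc]
  refine mul_le_mul' ?_ (le_trans ?_ h2)
  · rw [← ofReal_norm]
    apply ENNReal.ofReal_le_ofReal
    rw [norm_div, norm_mul, Complex.norm_I, norm_pow]
    have : ‖(p : ℂ) + 1‖ = p + 1 := by
      rw [show (p : ℂ) + 1 = ((p + 1 : ℕ) : ℂ) by push_cast; rfl, Complex.norm_natCast]; push_cast; rfl
    rw [this, mul_one, Complex.norm_ofNat]
    apply div_le_self (by positivity)
    exact one_le_pow₀ (by norm_num)
  · rw [enorm_le_iff_norm_le, norm_div]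
    apply div_le_self (norm_nonneg _)
    rw [Complex.norm_real, Real.norm_eq_abs, abs_of_pos (zeta_pos ..)]
    exact one_le_zeta ..

lemma r_bound (a b : ℝ) (p : ℕ) (τ : ℝ) (hτ : 0 < τ) (ψ : ℤ → ℂ) (l : ℤ) (hM : ME p ψ l ≠ ∞) :
    ‖∫ θ in (0 : ℝ)..τ, ∫ θ₁ in (0 : ℝ)..θ, Ftd a b p θ ψ (Ft a b p θ₁ ψ) l‖ₑ ≤
      ENNReal.ofReal (2 * (p + 1) * τ ^ 3) * ME p ψ l := by
  have h : ‖∫ θ in (0 : ℝ)..τ, ∫ θ₁ in (0 : ℝ)..θ, Ftd a b p θ ψ (Ft a b p θ₁ ψ) l‖ ≤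
      ((2 * (p + 1) * τ * (ME p ψ l).toReal) * τ) * |τ - 0| := by
    refine intervalIntegral.norm_integral_le_of_norm_le_const fun θ hθ => ?_
    rw [Set.uIoc_of_le hτ.le] at hθ
    have h' : ‖∫ θ₁ in (0 : ℝ)..θ, Ftd a b p θ ψ (Ft a b p θ₁ ψ) l‖ ≤
       (2 * (p + 1) * τ * (ME p ψ l).toReal) * |θ - 0| := by
      refine intervalIntegral.norm_integral_le_of_norm_le_const fun θ₁ hθ₁ => ?_
      rw [Set.uIoc_of_le hθ.1.le] at hθ₁
      have h3 := ENNReal.toReal_mono (ENNReal.mul_ne_top ENNReal.ofReal_ne_top hM)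
        (Ftd_bound a b p θ θ₁ ψ l)
      rw [toReal_enorm, ENNReal.toReal_mul, ENNReal.toReal_ofReal (by positivity)] at h3
      refine h3.trans ?_
      have h4 : |θ - θ₁| ≤ τ := by rw [abs_le]; constructor <;> linarith [hθ.1, hθ.2, hθ₁.1, hθ₁.2]
      calc _ ≤ (p + 1) * (2 * τ) * (ME p ψ l).toReal := by gcongr
        _ = _ := by ring
    refine h'.trans ?_
    rw [sub_zero, abs_of_pos hθ.1]
    gcongr
    exact hθ.2
  rw [sub_zero, abs_of_pos hτ] at h
  rw [← ofReal_norm]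
  refine (ENNReal.ofReal_le_ofReal h).trans (le_of_eq ?_)
  conv_rhs => rw [← ENNReal.ofReal_toReal hM]
  rw [← ENNReal.ofReal_mul (by positivity)]
  congr 1; ring

/-- Bound on the double-integral term
`r₂ = ∫₀^τ∫₀^θ F'_θ(ψ)(F_{θ₁}(ψ)) dθ₁dθ`: the cancellation
`F'_{τ/2}(ψ)(F_{τ/2}(ψ)) = 0` holds and
`‖r₂‖_s ≤ C(τ³ + τ⁴)‖ψ‖_s^{2p+1}`. -/
theorem double_integral_bound (a b : ℝ) (hab : a < b) (p : ℕ) (hp : 1 ≤ p)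
    (s : ℝ) (hs : 1 ≤ s) :
    ∃ C > 0, ∀ (ψ : ℤ → ℂ), MemHs a b s ψ → ∀ (τ : ℝ), 0 < τ →
      ∀ r₂ : ℤ → ℂ,
        (∀ l : ℤ, r₂ l = ∫ θ in (0 : ℝ)..τ, ∫ θ₁ in (0 : ℝ)..θ,
            Ftd a b p θ ψ (Ft a b p θ₁ ψ) l) →
        (∀ l : ℤ, Ftd a b p (τ / 2) ψ (Ft a b p (τ / 2) ψ) l = 0) ∧
        sobNorm a b s r₂ ≤ C * (τ ^ 3 + τ ^ 4) * sobNorm a b s ψ ^ (2 * p + 1) := by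
  set W := WE a b s with hWdef
  set K : ℝ≥0∞ := 2 * ENNReal.ofReal (4 ^ s) * ∑' m, (W m)⁻¹ with hKdef
  have hKtop : K ≠ ∞ := ENNReal.mul_ne_top (ENNReal.mul_ne_top (by norm_num) ENNReal.ofReal_ne_top)
    (WE_inv_sum a b s hab hs)
  have hW0 : ∀ m, W m ≠ 0 := fun m => (ENNReal.ofReal_pos.mpr (W_pos ..)).ne'
  have hK : ∀ f g, NE W (convE f g) ≤ K * (NE W f * NE W g) :=
    NE_conv W _ hW0 (fun m => ENNReal.ofReal_ne_top) (WE_sub a b s hs)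
  set A : ℝ := K.toReal ^ (2 * p + 2) * 4 ^ (2 * p + 1) with hA
  have hA0 : 0 ≤ A := by positivity
  refine ⟨2 * (p + 1) * Real.sqrt A + 1, by positivity, ?_⟩
  intro ψ hψ τ hτ r₂ hr
  refine ⟨fun l => Ftd_zero .., ?_⟩
  have hS0 : 0 ≤ sobNormSq a b s ψ := tsum_nonneg fun l => mul_nonneg (W_pos ..).le (by positivity)
  have hM : NE W (ME p ψ) ≤ ENNReal.ofReal (A * sobNormSq a b s ψ ^ (2 * p + 1)) := by
    have hp1 := NE_pow W K (WE_zero ..) hK (cE ψ) p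
    have hp2 := NE_pow W K (WE_zero ..) hK (cE ψ) (p + 1)
    calc _ ≤ K * (NE W (powE (cE ψ) p) * NE W (powE (cE ψ) (p + 1))) := hK _ _
      _ ≤ K * ((K ^ p * NE W (cE ψ) ^ p) * (K ^ (p + 1) * NE W (cE ψ) ^ (p + 1))) := by gcongr
      _ = K ^ (2 * p + 2) * NE W (cE ψ) ^ (2 * p + 1) := by ring
      _ ≤ K ^ (2 * p + 2) * (4 * ENNReal.ofReal (sobNormSq a b s ψ)) ^ (2 * p + 1) := by
        gcongr; rw [← NE_eq a b s ψ hψ]; exact NE_cE a b s ψ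
      _ = _ := by
        conv_lhs => rw [← ENNReal.ofReal_toReal hKtop, show (4 : ℝ≥0∞) = ENNReal.ofReal 4 by norm_num]
        rw [← ENNReal.ofReal_mul (by norm_num), ← ENNReal.ofReal_pow (by positivity),
          ← ENNReal.ofReal_pow (by positivity), ← ENNReal.ofReal_mul (by positivity), hA]
        congr 1; ring
  have hMl : ∀ l, ME p ψ l ≠ ∞ := by
    intro l hl
    have h1 : W l * ME p ψ l ^ 2 ≤ NE W (ME p ψ) := ENNReal.le_tsum (f := fun l => W l * ME p ψ l ^ 2) l
    have h2 := h1.trans hM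
    rw [hl, ENNReal.top_pow (by norm_num), ENNReal.mul_top (hW0 l), top_le_iff] at h2
    exact ENNReal.ofReal_ne_top h2
  have hR : NE W (fun l => ‖r₂ l‖ₑ) ≤
      ENNReal.ofReal ((2 * (p + 1) * τ ^ 3) ^ 2 * (A * sobNormSq a b s ψ ^ (2 * p + 1))) := by
    rw [ENNReal.ofReal_mul (by positivity), ENNReal.ofReal_pow (by positivity)]
    refine le_trans ?_ (mul_le_mul' le_rfl hM)
    unfold NE
    rw [← ENNReal.tsum_mul_left]
    refine ENNReal.tsum_le_tsum fun l => ?_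
    have := r_bound a b p τ hτ ψ l (hMl l)
    rw [← hr l] at this
    calc _ ≤ W l * (ENNReal.ofReal (2 * (p + 1) * τ ^ 3) * ME p ψ l) ^ 2 := by gcongr
      _ = _ := by ring
  have hfin : sobNormSq a b s r₂ ≤ (2 * (p + 1) * τ ^ 3) ^ 2 * (A * sobNormSq a b s ψ ^ (2 * p + 1)) := by
    rw [sobNormSq_eq a b s r₂]
    exact ENNReal.toReal_le_of_le_ofReal (by positivity) hR
  have hs0 : 0 ≤ sobNorm a b s ψ := Real.sqrt_nonneg _
  have hsq : sobNorm a b s ψ ^ 2 = sobNormSq a b s ψ := Real.sq_sqrt hS0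
  calc sobNorm a b s r₂ ≤ 2 * (p + 1) * τ ^ 3 * (Real.sqrt A * sobNorm a b s ψ ^ (2 * p + 1)) := by
        refine Real.sqrt_le_iff.mpr ⟨by positivity, hfin.trans (le_of_eq ?_)⟩
        rw [mul_pow _ (_ * _), mul_pow (Real.sqrt A), Real.sq_sqrt hA0, ← hsq]; ring
    _ = (2 * (p + 1) * Real.sqrt A) * τ ^ 3 * sobNorm a b s ψ ^ (2 * p + 1) := by ring
    _ ≤ _ := by
      have : 0 < τ ^ 4 := by positivity
      gcongr <;> linarith

end NKGE
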